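/- Let r ≥ 1 and work in the polynomial ring in variables x_1, …, x_r over ℚ. Let e_k denote the k-th elementary symmetric polynomial of x_1, …, x_r, and let Y be the family of the binom(r,2) sums x_i + x_j over pairs with 1 ≤ i < j ≤ r. Then the third elementary symmetric polynomial of the family Y equals binom(r−1, 3)·e_1³ + (r − 2)²·e_1·e_2 + (r − 4)·e_3. -/

import Mathlib

open MvPolynomial

theorem Multiset.esymm_cons_succ {R : Type*} [CommSemiring R] (a : R) (s : Multiset R) (n : ℕ) :
    (a ::ₘ s).esymm (n + 1) = s.esymm (n + 1) + a * s.esymm n := by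
  simp [Multiset.esymm, Multiset.powersetCard_cons, Multiset.sum_map_mul_left]

theorem Multiset.esymm_one_eq_sum {R : Type*} [CommSemiring R] (s : Multiset R) :
    s.esymm 1 = s.sum := by
  simp [Multiset.esymm, Multiset.powersetCard_one]

theorem Multiset.two_mul_esymm_two {R : Type*} [CommRing R] (s : Multiset R) :
    2 * s.esymm 2 = s.sum ^ 2 - (s.map (· ^ 2)).sum := by
  induction s using Multiset.induction with
  | empty => simp [Multiset.esymm, Multiset.powersetCard_zero_right]
  | cons a s ih =>
    rw [esymm_cons_succ, esymm_one_eq_sum, sum_cons, map_cons, sum_cons]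
    linear_combination ih

theorem Multiset.six_mul_esymm_three {R : Type*} [CommRing R] (s : Multiset R) :
    6 * s.esymm 3 =
      s.sum ^ 3 - 3 * s.sum * (s.map (· ^ 2)).sum + 2 * (s.map (· ^ 3)).sum := by
  induction s using Multiset.induction with
  | empty => simp [Multiset.esymm, Multiset.powersetCard_zero_right]
  | cons a s ih =>
    simp only [esymm_cons_succ, sum_cons, map_cons]
    linear_combination ih + 3 * a * s.two_mul_esymm_two

theorem Finset.two_mul_sum_filter_lt_of_symm {ι R : Type*} [Fintype ι] [LinearOrder ι]
    [CommRing R] (g : ι → ι → R) (hg : ∀ i j, g i j = g j i) :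
    2 * ∑ p : ι × ι with p.1 < p.2, g p.1 p.2 = ∑ i, ∑ j, g i j - ∑ i, g i i := by
  have hswap : ∑ i, ∑ j, (if i < j then g i j else 0) =
      ∑ i, ∑ j, (if j < i then g i j else 0) := by
    rw [sum_comm]
    simp only [hg]
  have hsplit : ∑ i, ∑ j, g i j = ∑ i, ∑ j, (if i < j then g i j else 0) +
      ∑ i, ∑ j, (if j < i then g i j else 0) + ∑ i, g i i := by
    rw [← sum_add_distrib, ← sum_add_distrib]
    refine sum_congr rfl fun i _ => ?_
    have hdiag : g i i = ∑ j, if i = j then g i j else 0 := by simp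
    rw [hdiag, ← sum_add_distrib, ← sum_add_distrib]
    refine sum_congr rfl fun j _ => ?_
    rcases lt_trichotomy i j with h | rfl | h
    · simp [h, h.not_gt, h.ne]
    · simp
    · simp [h, h.not_gt, h.ne']
  rw [sum_filter, Fintype.sum_prod_type, hsplit, ← hswap]
  ring

theorem Nat.cast_six_mul_choose_three {R : Type*} [CommRing R] (n : ℕ) :
    6 * (n.choose 3 : R) = n * (n - 1) * (n - 2) := by
  have h₂ (n : ℕ) : 2 * (n.choose 2 : R) = n * (n - 1) := by
    induction n with
    | zero => simp
    | succ n ih =>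
      rw [Nat.choose_succ_succ' n 1, Nat.choose_one_right]
      push_cast
      linear_combination ih
  induction n with
  | zero => simp
  | succ n ih =>
    rw [Nat.choose_succ_succ' n 2]
    push_cast
    linear_combination ih + 3 * h₂ n

/-- Splitting-principle content of Lemma A.3(iii): if `Y` is the family of the
`binom(r,2)` sums `xᵢ + xⱼ` over pairs with `i < j`, then the third elementary
symmetric polynomial of `Y` equals `binom(r−1,3)·e₁³ + (r−2)²·e₁·e₂ + (r−4)·e₃`. -/
theorem stmt_10 (r : ℕ) (hr : 1 ≤ r) :
    ((((Finset.univ : Finset (Fin r × Fin r)).filter (fun p => p.1 < p.2)).val.map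
        (fun p => (X p.1 + X p.2 : MvPolynomial (Fin r) ℚ))).esymm 3) =
      ((Nat.choose (r - 1) 3 : ℚ)) • (esymm (Fin r) ℚ 1) ^ 3 +
        (((r : ℚ) - 2) ^ 2) • (esymm (Fin r) ℚ 1 * esymm (Fin r) ℚ 2) +
        ((r : ℚ) - 4) • esymm (Fin r) ℚ 3 := by
  have hY := Multiset.six_mul_esymm_three
    (((Finset.univ : Finset (Fin r × Fin r)).filter (fun p => p.1 < p.2)).val.map
      (fun p => (X p.1 + X p.2 : MvPolynomial (Fin r) ℚ)))
  have h₂ := Multiset.two_mul_esymm_two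
    ((Finset.univ : Finset (Fin r)).val.map (X : Fin r → MvPolynomial (Fin r) ℚ))
  have h₃ := Multiset.six_mul_esymm_three
    ((Finset.univ : Finset (Fin r)).val.map (X : Fin r → MvPolynomial (Fin r) ℚ))
  have hp (k : ℕ) := Finset.two_mul_sum_filter_lt_of_symm
    (fun i j : Fin r => (X i + X j : MvPolynomial (Fin r) ℚ) ^ k) fun i j => by rw [add_comm]
  have hc := Nat.cast_six_mul_choose_three (R := MvPolynomial (Fin r) ℚ) (r - 1)
  rw [Nat.cast_sub hr, Nat.cast_one] at hc
  simp only [← esymm_eq_multiset_esymm, Multiset.map_map, Function.comp_def,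
    Finset.sum_map_val] at hY h₂ h₃
  rw [← esymm_one] at h₂ h₃
  have two_ne : (2 : MvPolynomial (Fin r) ℚ) ≠ 0 := two_ne_zero
  have hp₁ : ∑ p : Fin r × Fin r with p.1 < p.2, (X p.1 + X p.2 : MvPolynomial (Fin r) ℚ) =
      (r - 1) * esymm (Fin r) ℚ 1 := by
    refine mul_left_cancel₀ two_ne ?_
    have h := hp 1
    simp only [pow_one] at h
    rw [h, esymm_one]
    simp only [Finset.sum_add_distrib, Finset.sum_const, Finset.card_univ, Fintype.card_fin,
      nsmul_eq_mul, ← Finset.mul_sum]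
    ring
  have hp₂ : ∑ p : Fin r × Fin r with p.1 < p.2, (X p.1 + X p.2 : MvPolynomial (Fin r) ℚ) ^ 2 =
      (r - 2) * ∑ i : Fin r, (X i : MvPolynomial (Fin r) ℚ) ^ 2 + esymm (Fin r) ℚ 1 ^ 2 := by
    refine mul_left_cancel₀ two_ne ?_
    rw [hp 2, esymm_one]
    have hd (i : Fin r) : (X i + X i : MvPolynomial (Fin r) ℚ) ^ 2 = 4 * X i ^ 2 := by ring
    simp only [hd]
    simp only [add_sq, Finset.sum_add_distrib, Finset.sum_const, Finset.card_univ,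
      Fintype.card_fin, nsmul_eq_mul, ← Finset.mul_sum, ← Finset.sum_mul]
    ring
  have hp₃ : ∑ p : Fin r × Fin r with p.1 < p.2, (X p.1 + X p.2 : MvPolynomial (Fin r) ℚ) ^ 3 =
      (r - 4) * ∑ i : Fin r, (X i : MvPolynomial (Fin r) ℚ) ^ 3 +
        3 * esymm (Fin r) ℚ 1 * ∑ i : Fin r, (X i : MvPolynomial (Fin r) ℚ) ^ 2 := by
    refine mul_left_cancel₀ two_ne ?_
    rw [hp 3, esymm_one]
    have hd (i : Fin r) : (X i + X i : MvPolynomial (Fin r) ℚ) ^ 3 = 8 * X i ^ 3 := by ring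
    have he (i j : Fin r) : (X i + X j : MvPolynomial (Fin r) ℚ) ^ 3 =
        X i ^ 3 + 3 * X i ^ 2 * X j + 3 * X i * X j ^ 2 + X j ^ 3 := by ring
    simp only [hd]
    simp only [he, Finset.sum_add_distrib, Finset.sum_const, Finset.card_univ,
      Fintype.card_fin, nsmul_eq_mul, ← Finset.mul_sum, ← Finset.sum_mul]
    ring
  have hs₂ : ∑ i : Fin r, (X i : MvPolynomial (Fin r) ℚ) ^ 2 =
      esymm (Fin r) ℚ 1 ^ 2 - 2 * esymm (Fin r) ℚ 2 := by
    linear_combination h₂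
  rw [hs₂] at h₃ hp₂ hp₃
  have hs₃ : ∑ i : Fin r, (X i : MvPolynomial (Fin r) ℚ) ^ 3 =
      esymm (Fin r) ℚ 1 ^ 3 - 3 * esymm (Fin r) ℚ 1 * esymm (Fin r) ℚ 2 +
        3 * esymm (Fin r) ℚ 3 := by
    refine mul_left_cancel₀ two_ne ?_
    linear_combination -h₃
  rw [hp₁, hp₂, hp₃, hs₃] at hY
  have six_ne : (6 : MvPolynomial (Fin r) ℚ) ≠ 0 := by norm_num
  refine mul_left_cancel₀ six_ne ?_
  simp only [smul_eq_C_mul, map_sub, map_pow, map_natCast, map_ofNat]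
  linear_combination hY - esymm (Fin r) ℚ 1 ^ 3 * hc
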